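/- Let k be an algebraically closed field, X a generating pattern on [n], s > 2 an odd integer, and σ_1,…,σ_s distinct subsets of [n] (vertices of the Taylor graph). Suppose that either (A) σ_1 and σ_s have no outgoing Taylor edges, the unique Taylor edge with target σ_1 has source σ_2, the unique Taylor edge with target σ_s has source σ_{s−1}, and for each odd j with 1 < j < s the Taylor edges with target σ_j are exactly two, with sources σ_{j−1} and σ_{j+1}; or (B) σ_1 and σ_s have no incoming Taylor edges, the unique Taylor edge with source σ_1 has target σ_2, the unique Taylor edge with source σ_s has target σ_{s−1}, and for each odd j with 1 < j < s the Taylor edges with source σ_j are exactly two, with targets σ_{j−1} and σ_{j+1}. Then V_X = k^n. (Here a Taylor edge is a differential or homotopy edge of the Taylor graph of X.) -/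

import Mathlib

open scoped Classical

noncomputable section

/-- A *generating pattern* on `[n]`: a finite set `X` of nonempty subsets of `Fin n`
such that for all `i ≠ j` there is `σ ∈ X` with `i ∈ σ` and `j ∉ σ`. -/
def IsGenPattern (n : ℕ) (X : Finset (Finset (Fin n))) : Prop :=
  (∀ σ ∈ X, σ.Nonempty) ∧ ∀ i j : Fin n, i ≠ j → ∃ σ ∈ X, i ∈ σ ∧ j ∉ σ

/-- Adjacency in the GCD graph of a generating pattern. -/
def GcdAdj {n : ℕ} (X : Finset (Finset (Fin n))) (i j : Fin n) : Prop :=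
  i ≠ j ∧ ∃ σ ∈ X, i ∈ σ ∧ j ∈ σ

/-- The neighborhood of a set of vertices in the GCD graph. -/
def Nbhd {n : ℕ} (X : Finset (Finset (Fin n))) (S : Finset (Fin n)) : Finset (Fin n) :=
  Finset.univ.filter fun j => ∃ i ∈ S, GcdAdj X i j

/-- The differential edge `d_{σ,i}` (from `σ ∪ {i}` to `σ`) exists. -/
def DiffEdge {n : ℕ} (X : Finset (Finset (Fin n))) (σ : Finset (Fin n)) (i : Fin n) : Prop :=
  i ∉ σ ∧ ∀ τ ∈ X, i ∈ τ → (τ ∩ σ).Nonempty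

/-- The homotopy edge `h_{σ,i}` (from `σ` to `σ ∪ {i}`) exists. -/
def HomEdge {n : ℕ} (X : Finset (Finset (Fin n))) (σ : Finset (Fin n)) (i : Fin n) : Prop :=
  i ∉ σ ∧ i ∉ Nbhd X σ

/-- `sign(σ, i) = (-1)^{|{j ∈ σ : j < i}|}`. -/
def edgeSign {n : ℕ} (σ : Finset (Fin n)) (i : Fin n) : ℤ :=
  (-1) ^ (σ.filter fun j => j < i).card

/-- The Taylor matrix of the generating pattern `X`, evaluated at the point `a : Fin n → k`. -/
def taylorMatrixAt {n : ℕ} {k : Type*} [Field k] (X : Finset (Finset (Fin n)))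
    (a : Fin n → k) : Matrix (Finset (Fin n)) (Finset (Fin n)) k :=
  fun r c =>
    (∑ i : Fin n, if c = insert i r ∧ DiffEdge X r i then (edgeSign r i : k) else 0) +
      ∑ i : Fin n, if r = insert i c ∧ HomEdge X c i then (edgeSign c i : k) * a i else 0

/-- The cohomological support variety `V_X ⊆ k^n`: the locus where all
`2^(n-1) × 2^(n-1)` minors of the Taylor matrix vanish. -/
def supportVariety {n : ℕ} (k : Type*) [Field k] (X : Finset (Finset (Fin n))) :
    Set (Fin n → k) :=
  { a | ∀ f g : Fin (2 ^ (n - 1)) → Finset (Fin n),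
      Function.Injective f → Function.Injective g →
      ((taylorMatrixAt X a).submatrix f g).det = 0 }

/-- A Taylor edge from `u` to `v`: either a differential edge `d_{v,i}` with
`u = v ∪ {i}`, or a homotopy edge `h_{u,i}` with `v = u ∪ {i}`. -/
def TaylorEdge {n : ℕ} (X : Finset (Finset (Fin n))) (u v : Finset (Fin n)) : Prop :=
  (∃ i : Fin n, DiffEdge X v i ∧ u = insert i v) ∨
    (∃ i : Fin n, HomEdge X u i ∧ v = insert i u)


def flp {n : ℕ} (c : Finset (Fin n)) (i : Fin n) : Finset (Fin n) :=
  if i ∈ c then c.erase i else insert i c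

def Ed {n : ℕ} (X : Finset (Finset (Fin n))) (c : Finset (Fin n)) (i : Fin n) : Prop :=
  if i ∈ c then ∀ τ ∈ X, i ∈ τ → ∃ x ∈ τ, x ∈ c ∧ x ≠ i
  else ∀ τ ∈ X, i ∈ τ → ∀ x ∈ τ, x ∉ c

lemma mem_flp {n : ℕ} (c : Finset (Fin n)) (i x : Fin n) :
    x ∈ flp c i ↔ (x = i ∧ i ∉ c) ∨ (x ≠ i ∧ x ∈ c) := by
  unfold flp; split_ifs <;> simp <;> grind

lemma Ed_swap {n : ℕ} (X : Finset (Finset (Fin n))) (c : Finset (Fin n)) (i j : Fin n)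
    (hij : i ≠ j) (h : Ed X c i ∧ Ed X (flp c i) j) : Ed X c j ∧ Ed X (flp c j) i := by
  unfold Ed at *
  simp only [mem_flp] at *
  by_cases hi : i ∈ c <;> by_cases hj : j ∈ c <;>
    simp only [hi, hj, hij, hij.symm, if_true, if_false, not_true, not_false_iff, and_true, and_false,
      true_and, false_and, or_false, false_or, or_true, ne_eq] at h ⊢ <;> grind

lemma Ed_self {n : ℕ} (X : Finset (Finset (Fin n))) (c : Finset (Fin n)) (i : Fin n)
    (hi : ∃ τ ∈ X, i ∈ τ) (h : Ed X c i ∧ Ed X (flp c i) i) : False := by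
  unfold Ed at *
  simp only [mem_flp] at *
  obtain ⟨τ, h1, h2⟩ := hi
  by_cases hi : i ∈ c <;>
    simp only [hi, if_true, if_false, not_true, not_false_iff, and_true, and_false,
      true_and, false_and, or_false, false_or, or_true, ne_eq] at h ⊢ <;> grind

lemma Ed_of_mem {n : ℕ} (X : Finset (Finset (Fin n))) (r : Finset (Fin n)) (i : Fin n) (hi : i ∉ r) :
    DiffEdge X r i ↔ Ed X (insert i r) i := by
  unfold DiffEdge Ed
  simp only [Finset.mem_insert_self, if_true, Finset.Nonempty, Finset.mem_inter, Finset.mem_insert]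
  grind

lemma Ed_of_not_mem {n : ℕ} (X : Finset (Finset (Fin n))) (r : Finset (Fin n)) (i : Fin n) (hi : i ∉ r) :
    HomEdge X r i ↔ Ed X r i := by
  unfold HomEdge Ed Nbhd GcdAdj
  simp only [hi, if_false, Finset.mem_filter, Finset.mem_univ, true_and, not_false_iff]
  grind

lemma diff_iff {n : ℕ} (X : Finset (Finset (Fin n))) (r c : Finset (Fin n)) (i : Fin n) :
    (c = insert i r ∧ DiffEdge X r i) ↔ (i ∈ c ∧ r = flp c i ∧ Ed X c i) := by
  constructor
  · rintro ⟨rfl, h⟩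
    have := h.1
    refine ⟨by simp, ?_, (Ed_of_mem X r i this).1 h⟩
    simp [flp, this]
  · rintro ⟨h, rfl, h2⟩
    have : flp c i = c.erase i := by simp [flp, h]
    rw [this]
    have h3 : c = insert i (c.erase i) := by simp [h]
    exact ⟨h3, by rw [Ed_of_mem _ _ _ (by simp), ← h3]; exact h2⟩

lemma hom_iff {n : ℕ} (X : Finset (Finset (Fin n))) (r c : Finset (Fin n)) (i : Fin n) :
    (r = insert i c ∧ HomEdge X c i) ↔ (i ∉ c ∧ r = flp c i ∧ Ed X c i) := by
  constructor
  · rintro ⟨rfl, h⟩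
    exact ⟨h.1, by simp [flp, h.1], (Ed_of_not_mem X c i h.1).1 h⟩
  · rintro ⟨h, rfl, h2⟩
    exact ⟨by simp [flp, h], (Ed_of_not_mem X c i h).2 h2⟩

lemma taylor_iff {n : ℕ} (X : Finset (Finset (Fin n))) (r c : Finset (Fin n)) :
    TaylorEdge X c r ↔ ∃ i, r = flp c i ∧ Ed X c i := by
  have h1 := fun i => diff_iff X r c i
  have h2 := fun i => hom_iff X r c i
  unfold TaylorEdge
  constructor
  · rintro (⟨i, h⟩ | ⟨i, h⟩)
    · exact ⟨i, ((h1 i).1 h.symm).2⟩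
    · exact ⟨i, ((h2 i).1 h.symm).2⟩
  · rintro ⟨i, h⟩
    by_cases hi : i ∈ c
    · exact Or.inl ⟨i, ((h1 i).2 ⟨hi, h⟩).symm⟩
    · exact Or.inr ⟨i, ((h2 i).2 ⟨hi, h⟩).symm⟩

lemma flp_inj {n : ℕ} (c : Finset (Fin n)) (i j : Fin n) (h : flp c i = flp c j) : i = j := by
  have := mem_flp c i i
  have := mem_flp c j i
  grind

lemma sign_flp {n : ℕ} (c : Finset (Fin n)) (i j : Fin n) :
    edgeSign (flp c i) j = if i < j then - edgeSign c j else edgeSign c j := by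
  unfold edgeSign
  by_cases hi : i ∈ c
  · have e : flp c i = c.erase i := by simp [flp, hi]
    rw [e, Finset.filter_erase]
    split_ifs with h
    · rw [← Finset.card_erase_add_one (s := c.filter fun x => x < j) (a := i) (by simp [hi, h])]
      rw [pow_succ]; ring
    · rw [Finset.erase_eq_of_notMem (by simp [h])]
  · have e : flp c i = insert i c := by simp [flp, hi]
    rw [e, Finset.filter_insert]
    split_ifs with h
    · rw [Finset.card_insert_of_notMem (by simp [hi]), pow_succ]; ring
    · rfl

section
variable {n : ℕ} {k : Type*} [Field k]

def wt (a : Fin n → k) (c : Finset (Fin n)) (i : Fin n) : k := if i ∈ c then 1 else a i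

def cf (X : Finset (Finset (Fin n))) (a : Fin n → k) (c : Finset (Fin n)) (i : Fin n) : k :=
  if Ed X c i then (edgeSign c i : k) * wt a c i else 0

lemma taylor_eq (X : Finset (Finset (Fin n))) (a : Fin n → k) (r c : Finset (Fin n)) :
    taylorMatrixAt X a r c = ∑ i, if r = flp c i then cf X a c i else 0 := by
  unfold taylorMatrixAt
  rw [← Finset.sum_add_distrib]
  refine Finset.sum_congr rfl fun i _ => ?_
  simp only [diff_iff, hom_iff, cf, wt]
  by_cases h : r = flp c i
  · by_cases hi : i ∈ c
    · have hs : edgeSign r i = edgeSign c i := by rw [h, sign_flp]; simp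
      simp [h, hi, ← hs]
    · simp [h, hi]
  · simp [h]

lemma cf_swap (X : Finset (Finset (Fin n))) (a : Fin n → k) (c : Finset (Fin n)) (i j : Fin n)
    (hij : i ≠ j) : cf X a c i * cf X a (flp c i) j + cf X a c j * cf X a (flp c j) i = 0 := by
  have hw : ∀ i j : Fin n, i ≠ j → wt a (flp c i) j = wt a c j := by
    intro i j h
    have := mem_flp c i j
    have h2 : j ∈ flp c i ↔ j ∈ c := by grind
    simp [wt, h2]
  have hiff : (Ed X c i ∧ Ed X (flp c i) j) ↔ (Ed X c j ∧ Ed X (flp c j) i) :=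
    ⟨Ed_swap X c i j hij, Ed_swap X c j i hij.symm⟩
  unfold cf
  rw [hw i j hij, hw j i hij.symm, sign_flp, sign_flp]
  by_cases h : Ed X c i ∧ Ed X (flp c i) j
  · have h' := hiff.1 h
    simp only [h.1, h.2, h'.1, h'.2, if_true]
    rcases lt_or_gt_of_ne hij with hl | hl
    · simp only [hl, hl.not_gt, if_true, if_false]; push_cast; ring
    · simp only [hl, hl.not_gt, if_true, if_false]; push_cast; ring
  · have h' := fun x => h (hiff.2 x)
    have e1 : ∀ (P Q : Prop) (x y : k), ¬ (P ∧ Q) → (if P then x else 0) * (if Q then y else 0) = 0 := by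
      intro P Q x y h
      by_cases hP : P <;> by_cases hQ : Q <;> simp_all
    rw [e1 _ _ _ _ h, e1 _ _ _ _ h', add_zero]

lemma cf_self (X : Finset (Finset (Fin n))) (a : Fin n → k) (c : Finset (Fin n)) (i : Fin n)
    (hi : ∃ τ ∈ X, i ∈ τ) : cf X a c i * cf X a (flp c i) i = 0 := by
  have := Ed_self X c i hi
  unfold cf
  by_cases h1 : Ed X c i <;> by_cases h2 : Ed X (flp c i) i <;> simp_all

lemma flp_comm (c : Finset (Fin n)) (i j : Fin n) : flp (flp c i) j = flp (flp c j) i := by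
  ext x
  simp only [mem_flp]
  grind

lemma taylor_sq (X : Finset (Finset (Fin n))) (a : Fin n → k) (hX : ∀ i, ∃ τ ∈ X, i ∈ τ) :
    taylorMatrixAt X a * taylorMatrixAt X a = 0 := by
  ext r c
  rw [Matrix.mul_apply]
  simp only [taylor_eq, Matrix.zero_apply, Finset.sum_mul_sum]
  have : ∀ t : Finset (Fin n), (∑ i, ∑ j, (if r = flp t i then cf X a t i else 0) *
      (if t = flp c j then cf X a c j else 0)) = ∑ j, if t = flp c j then
        (∑ i, if r = flp (flp c j) i then cf X a c j * cf X a (flp c j) i else 0) else 0 := by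
    intro t
    rw [Finset.sum_comm]
    refine Finset.sum_congr rfl fun j _ => ?_
    by_cases h : t = flp c j
    · subst h
      simp only [if_true]
      refine Finset.sum_congr rfl fun i _ => ?_
      split_ifs <;> simp [mul_comm]
    · simp [h]
  simp only [this]
  rw [Finset.sum_comm]
  simp only [Finset.sum_ite_eq', Finset.sum_ite_eq, Finset.mem_univ, if_true]
  rw [← Finset.sum_product']
  refine Finset.sum_involution (fun p _ => (p.2, p.1)) ?_ ?_ ?_ ?_
  · rintro ⟨i, j⟩ -
    simp only
    rw [flp_comm c j i]
    by_cases h : r = flp (flp c i) j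
    · simp only [h, if_true]
      by_cases hij : i = j
      · subst hij; simp [cf_self X a c i (hX i)]
      · exact cf_swap X a c i j hij
    · simp [h]
  · rintro ⟨i, j⟩ - h h2
    simp only [Prod.mk.injEq] at h2
    obtain ⟨rfl, -⟩ := h2
    apply h
    simp [cf_self X a c _ (hX _)]
  · simp
  · simp

lemma taylor_ne (X : Finset (Finset (Fin n))) (a : Fin n → k) (ha : ∀ i, a i ≠ 0)
    (r c : Finset (Fin n)) : taylorMatrixAt X a r c ≠ 0 ↔ TaylorEdge X c r := by
  rw [taylor_eq, taylor_iff]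
  have hcf : ∀ i, cf X a c i ≠ 0 ↔ Ed X c i := by
    intro i
    have : (edgeSign c i : k) * wt a c i ≠ 0 := by
      apply mul_ne_zero
      · unfold edgeSign; push_cast; exact pow_ne_zero _ (by simp)
      · unfold wt; split_ifs; exacts [one_ne_zero, ha i]
    unfold cf
    split_ifs with h <;> simp_all
  by_cases h : ∃ i, r = flp c i
  · obtain ⟨i, rfl⟩ := h
    rw [Finset.sum_eq_single i]
    · simp only [if_true, hcf]
      constructor
      · intro h; exact ⟨i, rfl, h⟩
      · rintro ⟨j, h, h2⟩
        rwa [flp_inj _ _ _ h]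
    · intro j _ hj
      rw [if_neg]
      intro h; exact hj (flp_inj _ _ _ h).symm
    · simp
  · push Not at h
    simp [h]

end

lemma rank_lt {ι k : Type*} [Fintype ι] [Field k] (N : Matrix ι ι k) (hN : N * N = 0)
    (m : ℕ) (hm : Fintype.card ι = 2 * m) (w : ι → k) (hw : N.mulVec w = 0)
    (hw2 : ∀ u, N.mulVec u ≠ w) : N.rank < m := by
  have h1 := LinearMap.finrank_range_add_finrank_ker N.mulVecLin
  rw [Module.finrank_fintype_fun_eq_card, hm] at h1
  have h2 : LinearMap.range N.mulVecLin < LinearMap.ker N.mulVecLin := by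
    refine lt_of_le_of_ne ?_ ?_
    · rintro _ ⟨u, rfl⟩
      simp [hN]
    · intro h
      have : w ∈ LinearMap.ker N.mulVecLin := by simpa using hw
      rw [← h] at this
      obtain ⟨u, hu⟩ := this
      exact hw2 u hu
  have h3 := Submodule.finrank_lt_finrank_of_lt h2
  rw [Matrix.rank]
  omega

lemma det_zero {ι k : Type*} [Fintype ι] [Field k] (N : Matrix ι ι k) (m : ℕ)
    (h : N.rank < m) (f g : Fin m → ι) : (N.submatrix f g).det = 0 := by
  by_contra hd
  have h1 : (N.submatrix f g).rank = m := by
    rw [Matrix.rank_of_isUnit, Fintype.card_fin]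
    rw [Matrix.isUnit_iff_isUnit_det]
    exact isUnit_iff_ne_zero.2 hd
  have := Matrix.rank_submatrix_le N f g
  omega

lemma key {ι k : Type*} [Fintype ι] [Field k] (N : Matrix ι ι k) (hN : N * N = 0)
    (m : ℕ) (hm : Fintype.card ι = 2 * m) (p : ℕ) (τ : ℕ → ι)
    (hinj : ∀ i j : ℕ, i < 2 * p + 1 → j < 2 * p + 1 → τ i = τ j → i = j)
    (h0 : ∀ c, N (τ 0) c = 0)
    (h : ∀ j ≤ p, ∀ r, N r (τ (2 * j)) ≠ 0 ↔
      (j < p ∧ r = τ (2 * j + 1)) ∨ (0 < j ∧ r = τ (2 * j - 1))) : N.rank < m := by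
  let b : ℕ → k := fun j => Nat.rec 1 (fun j x =>
    - x * N (τ (2 * j + 1)) (τ (2 * j)) / N (τ (2 * j + 1)) (τ (2 * (j + 1)))) j
  have hb0 : b 0 = 1 := rfl
  have hb : ∀ j, b (j + 1) = - b j * N (τ (2 * j + 1)) (τ (2 * j)) /
    N (τ (2 * j + 1)) (τ (2 * (j + 1))) := fun j => rfl
  clear_value b
  let w : ι → k := ∑ j ∈ Finset.range (p + 1), b j • Pi.single (τ (2 * j)) 1
  refine rank_lt N hN m hm w ?_ ?_
  · ext r
    have e : N.mulVec w r = ∑ j ∈ Finset.range (p + 1), b j * N r (τ (2 * j)) := by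
      simp [w, Matrix.mulVec_sum, Matrix.mulVec_smul]
    rw [e]
    by_cases hr : ∃ l < p, r = τ (2 * l + 1)
    · obtain ⟨l, hl, rfl⟩ := hr
      rw [← Finset.sum_subset (s₁ := {l, l + 1})]
      · rw [Finset.sum_pair (by omega), hb]
        have : N (τ (2 * l + 1)) (τ (2 * (l + 1))) ≠ 0 := by
          rw [h _ (by omega)]
          right
          exact ⟨by omega, by congr 1⟩
        field_simp
        simp
      · intro x; simp; omega
      · intro x hx hx2
        simp at hx hx2
        rw [mul_eq_zero]; right
        by_contra hne
        replace hne := (h x (by omega) _).1 hne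
        rcases hne with ⟨h1, h2⟩ | ⟨h1, h2⟩
        · have := hinj _ _ (by omega) (by omega) h2; omega
        · have := hinj _ _ (by omega) (by omega) h2; omega
    · apply Finset.sum_eq_zero
      intro x hx
      simp at hx
      rw [mul_eq_zero]; right
      by_contra hne
      replace hne := (h x (by omega) _).1 hne
      apply hr
      rcases hne with ⟨h1, h2⟩ | ⟨h1, h2⟩
      · exact ⟨x, h1, h2⟩
      · exact ⟨x - 1, by omega, by rw [h2]; congr 1; omega⟩
  · intro u hu
    have h1 : w (τ 0) = 1 := by
      simp only [w, Finset.sum_apply, Pi.smul_apply, smul_eq_mul]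
      rw [Finset.sum_eq_single 0]
      · simp [hb0]
      · intro x hx hx0
        simp at hx
        rw [Pi.single_eq_of_ne, mul_zero]
        intro he
        have := hinj _ _ (by omega) (by omega) he
        omega
      · simp
    rw [← hu] at h1
    simp [Matrix.mulVec, dotProduct, h0] at h1

/-- An odd-length path of vertices in the Taylor graph (with `σ 0, …, σ (s-1)` listing
`σ_1, …, σ_s`, so odd `1`-indexed positions are even `0`-indexed positions), whose
odd-position vertices are sinks (case A) or sources (case B) with the prescribed
incident edges, forces full support. -/
theorem odd_length_path_full_support (n : ℕ) (k : Type*) [Field k] [IsAlgClosed k]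
    (X : Finset (Finset (Fin n))) (hX : IsGenPattern n X)
    (s : ℕ) (hs : 2 < s) (hodd : Odd s)
    (σ : ℕ → Finset (Fin n))
    (hinj : ∀ i j : ℕ, i < s → j < s → σ i = σ j → i = j)
    (hAB :
      ((∀ v, ¬ TaylorEdge X (σ 0) v) ∧ (∀ v, ¬ TaylorEdge X (σ (s - 1)) v) ∧
        (∀ u, TaylorEdge X u (σ 0) ↔ u = σ 1) ∧
        (∀ u, TaylorEdge X u (σ (s - 1)) ↔ u = σ (s - 2)) ∧
        (∀ j : ℕ, 0 < j → j < s - 1 → Even j →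
          ∀ u, TaylorEdge X u (σ j) ↔ (u = σ (j - 1) ∨ u = σ (j + 1)))) ∨
      ((∀ u, ¬ TaylorEdge X u (σ 0)) ∧ (∀ u, ¬ TaylorEdge X u (σ (s - 1))) ∧
        (∀ v, TaylorEdge X (σ 0) v ↔ v = σ 1) ∧
        (∀ v, TaylorEdge X (σ (s - 1)) v ↔ v = σ (s - 2)) ∧
        (∀ j : ℕ, 0 < j → j < s - 1 → Even j →
          ∀ v, TaylorEdge X (σ j) v ↔ (v = σ (j - 1) ∨ v = σ (j + 1))))) :
    supportVariety k X = Set.univ := by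
  have hn : 2 ≤ n := by
    by_contra hn
    have hc : Fintype.card (Finset (Fin n)) ≤ 2 := by
      rw [Fintype.card_finset, Fintype.card_fin]
      have : n = 0 ∨ n = 1 := by omega
      rcases this with rfl | rfl <;> norm_num
    have hi : Function.Injective (fun i : Fin 3 => σ i) := by
      intro i j h
      exact Fin.ext (hinj _ _ (by omega) (by omega) h)
    have := Fintype.card_le_of_injective _ hi
    simp only [Fintype.card_fin] at this
    omega
  have hcov : ∀ i, ∃ τ ∈ X, i ∈ τ := by
    intro i
    haveI : Nontrivial (Fin n) := Fin.nontrivial_iff_two_le.2 hn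
    obtain ⟨j, hj⟩ := exists_ne i
    obtain ⟨τ, h1, h2, -⟩ := hX.2 i j hj.symm
    exact ⟨τ, h1, h2⟩
  have hcard : Fintype.card (Finset (Fin n)) = 2 * 2 ^ (n - 1) := by
    rw [Fintype.card_finset, Fintype.card_fin, ← pow_succ']
    congr 1; omega
  obtain ⟨p, rfl⟩ := hodd
  have hgen : ∀ a : Fin n → k, (∀ i, a i ≠ 0) → (taylorMatrixAt X a).rank < 2 ^ (n - 1) := by
    intro a ha
    have hsq := taylor_sq X a hcov
    have hne := taylor_ne X a ha
    rcases hAB with ⟨h1, -, h2, h3, h4⟩ | ⟨h1, -, h2, h3, h4⟩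
    · rw [← Matrix.rank_transpose]
      refine key _ (by rw [← Matrix.transpose_mul, hsq, Matrix.transpose_zero]) _ hcard p σ hinj ?_ ?_
      · intro c
        by_contra hc
        exact h1 _ ((hne _ _).1 hc)
      · intro j hj r
        rw [Matrix.transpose_apply, hne]
        rcases Nat.eq_zero_or_pos j with rfl | hj0
        · rw [h2]; simp; omega
        · rcases hj.eq_or_lt with rfl | hlt
          · have := h3 r
            simp only [show 2 * j + 1 - 1 = 2 * j by omega, show 2 * j + 1 - 2 = 2 * j - 1 by omega] at this
            rw [this]; simp [hj0]
          · rw [h4 (2 * j) (by omega) (by omega) (by simp)]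
            simp [hj0, hlt, or_comm]
    · refine key _ hsq _ hcard p σ hinj ?_ ?_
      · intro c
        by_contra hc
        exact h1 _ ((hne _ _).1 hc)
      · intro j hj r
        rw [hne]
        rcases Nat.eq_zero_or_pos j with rfl | hj0
        · rw [h2]; simp; omega
        · rcases hj.eq_or_lt with rfl | hlt
          · have := h3 r
            simp only [show 2 * j + 1 - 1 = 2 * j by omega, show 2 * j + 1 - 2 = 2 * j - 1 by omega] at this
            rw [this]; simp [hj0]
          · rw [h4 (2 * j) (by omega) (by omega) (by simp)]
            simp [hj0, hlt, or_comm]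
  rw [Set.eq_univ_iff_forall]
  intro a f g hf hg
  let P : Matrix (Finset (Fin n)) (Finset (Fin n)) (MvPolynomial (Fin n) k) := fun r c =>
    (∑ i : Fin n, if c = insert i r ∧ DiffEdge X r i then MvPolynomial.C (edgeSign r i : k) else 0) +
      ∑ i : Fin n, if r = insert i c ∧ HomEdge X c i then
        MvPolynomial.C (edgeSign c i : k) * MvPolynomial.X i else 0
  have hP : ∀ a : Fin n → k, MvPolynomial.eval a ((P.submatrix f g).det) =
      ((taylorMatrixAt X a).submatrix f g).det := by
    intro a
    rw [RingHom.map_det]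
    congr 1
    ext r c
    simp only [RingHom.mapMatrix_apply, Matrix.map_apply, Matrix.submatrix_apply]
    simp only [P, taylorMatrixAt, map_add, map_sum]
    congr 1 <;> refine Finset.sum_congr rfl fun i _ => ?_ <;> split_ifs <;> simp
  have hz : (P.submatrix f g).det * ∏ i : Fin n, MvPolynomial.X i = 0 := by
    haveI : Infinite k := IsAlgClosed.instInfinite
    apply MvPolynomial.funext
    intro a
    rw [map_mul, map_prod, map_zero, hP]
    by_cases ha : ∀ i, a i ≠ 0
    · rw [det_zero _ _ (hgen a ha), zero_mul]
    · push Not at ha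
      obtain ⟨i, hi⟩ := ha
      rw [Finset.prod_eq_zero (Finset.mem_univ i) (by simpa using hi), mul_zero]
  rcases mul_eq_zero.1 hz with h | h
  · rw [← hP, h, map_zero]
  · rw [Finset.prod_eq_zero_iff] at h
    obtain ⟨i, -, hi⟩ := h
    exact absurd hi (MvPolynomial.X_ne_zero i)
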